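/- Let X be a real Banach space containing an isomorphic copy of ℓ∞ (i.e., there is a closed linear subspace of X that is linearly homeomorphic to the space ℓ∞ of bounded real sequences with the supremum norm). Then X contains isometrically any bounded separable strongly concave metric space: for every metric space (M,d) that is bounded, separable, and c-strongly concave for some c > 0, there exists an isometric embedding of (M,d) into X. -/

import Mathlib

open scoped ENNReal

abbrev LInf (α : Type*) := lp (fun _ : α => ℝ) ∞

def LInf.mk {α : Type*} (u : α → ℝ) (C : ℝ) (h : ∀ a, |u a| ≤ C) : LInf α :=
  ⟨u, memℓp_infty ⟨C, by rintro _ ⟨a, rfl⟩; exact h a⟩⟩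

theorem LInf.mk_apply {α : Type*} (u : α → ℝ) (C : ℝ) (h : ∀ a, |u a| ≤ C) (a : α) :
    LInf.mk u C h a = u a := rfl

theorem LInf.abs_le {α : Type*} (u : LInf α) (a : α) : |u a| ≤ ‖u‖ := by
  have := lp.norm_apply_le_norm (by simp) u a
  simpa using this

theorem LInf.norm_le {α : Type*} (u : LInf α) (C : ℝ) (hC : 0 ≤ C) (h : ∀ a, |u a| ≤ C) :
    ‖u‖ ≤ C := lp.norm_le_of_forall_le hC h

/-- multiply and precompose -/
noncomputable def LInf.comp {α β : Type*} (p : α → β) (g : α → ℝ) (hg : ∀ a, |g a| ≤ 1) :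
    LInf β →ₗ[ℝ] LInf α where
  toFun u := LInf.mk (fun a => u (p a) * g a) ‖u‖ (fun a => by
    rw [abs_mul]
    have := LInf.abs_le u (p a)
    nlinarith [hg a, abs_nonneg (g a), abs_nonneg (u (p a))])
  map_add' u v := by
    ext a
    simp [LInf.mk_apply, add_mul]
  map_smul' c u := by
    ext a
    simp [LInf.mk_apply, mul_assoc]

theorem LInf.comp_apply {α β : Type*} (p : α → β) (g : α → ℝ) (hg : ∀ a, |g a| ≤ 1)
    (u : LInf β) (a : α) : LInf.comp p g hg u a = u (p a) * g a := rfl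

/-- Given an isomorphic copy of `ℓ∞`, find almost isometric copy (James, Partington). -/
theorem almost_isometric {X : Type*} [NormedAddCommGroup X] [NormedSpace ℝ X]
    (U : LInf ℕ →ₗ[ℝ] X) (m K : ℝ) (hm : 0 < m) (hlow : ∀ x, m * ‖x‖ ≤ ‖U x‖)
    (hup : ∀ x, ‖U x‖ ≤ K * ‖x‖) (M : Type*) [Countable M] [Nonempty M] (δ : ℝ) (hδ : 0 < δ) :
    ∃ T : LInf M →ₗ[ℝ] X, ∀ x, ‖x‖ ≤ ‖T x‖ ∧ ‖T x‖ ≤ (1 + δ) * ‖x‖ := by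
  classical
  set S : Set ℝ := {t | ∃ A : Set ℕ, A.Infinite ∧ ∀ x : LInf ℕ, ‖x‖ ≤ 1 → (∀ i, i ∉ A → x i = 0) →
    ‖U x‖ ≤ t} with hS
  have hK0 : 0 ≤ K := by
    have h1 := hlow (lp.single ∞ 0 1)
    have h2 := hup (lp.single ∞ 0 1)
    rw [lp.norm_single (by simp)] at h1 h2
    norm_num at h1 h2
    linarith
  have hSne : S.Nonempty := ⟨K, Set.univ, Set.infinite_univ, fun x hx _ =>
    (hup x).trans (by nlinarith)⟩
  have hSm : ∀ t ∈ S, m ≤ t := by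
    rintro t ⟨A, hA, h⟩
    obtain ⟨i, hi⟩ := hA.nonempty
    have h1 := hlow (lp.single ∞ i 1)
    have h2 := h (lp.single ∞ i 1) (by rw [lp.norm_single (by simp)]; simp) (by
      intro j hj
      have : j ≠ i := fun h => hj (h ▸ hi)
      simp [lp.single_apply, this])
    rw [lp.norm_single (by simp)] at h1
    norm_num at h1
    linarith
  have hSb : BddBelow S := ⟨m, hSm⟩
  set L := sInf S with hL
  have hLm : m ≤ L := le_csInf hSne hSm
  have hL0 : 0 < L := by linarith
  -- small parameter
  obtain ⟨η, hη0, hη1, hη⟩ : ∃ η : ℝ, 0 < η ∧ η < 1 / 6 ∧ (1 + η) ≤ (1 + δ) * (1 - 3 * η) := by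
    refine ⟨min (1/7) (δ / (4 + 3 * δ)), by positivity, ?_, ?_⟩
    · exact lt_of_le_of_lt (min_le_left _ _) (by norm_num)
    · have h1 : min (1/7) (δ / (4 + 3 * δ)) ≤ δ / (4 + 3 * δ) := min_le_right _ _
      rw [le_div_iff₀ (by positivity)] at h1
      nlinarith
  obtain ⟨t, ⟨A, hA, hAt⟩, ht⟩ := exists_lt_of_csInf_lt hSne (show sInf S < (1 + η) * L by nlinarith)
  have hB : ∀ B : Set ℕ, B.Infinite → ∃ x : LInf ℕ, ‖x‖ ≤ 1 ∧ (∀ i, i ∉ B → x i = 0) ∧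
      (1 - η) * L < ‖U x‖ := by
    intro B hB
    by_contra! hcon
    have : (1 - η) * L ∈ S := ⟨B, hB, hcon⟩
    have := csInf_le hSb this
    nlinarith
  have : Infinite A := hA.to_subtype
  obtain ⟨e⟩ : Nonempty (A ≃ M × ℕ) := nonempty_equiv_of_countable
  set p : ℕ → M := fun a => if h : a ∈ A then (e ⟨a, h⟩).1 else Classical.arbitrary M with hp
  have hBinf : ∀ n : M, {a | a ∈ A ∧ p a = n}.Infinite := by
    intro n
    refine Set.infinite_of_injective_forall_mem (f := fun j : ℕ => ((e.symm (n, j) : A) : ℕ)) ?_ ?_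
    · intro j j' h
      have := e.symm.injective (Subtype.ext h)
      simpa using this
    · intro j
      simp [hp]
  choose x hx1 hx2 hx3 using fun n => hB _ (hBinf n)
  set g : ℕ → ℝ := fun a => x (p a) a with hg
  have hg1 : ∀ a, |g a| ≤ 1 := fun a => (LInf.abs_le _ _).trans (hx1 _)
  have hgA : ∀ a, a ∉ A → g a = 0 := fun a ha => hx2 _ _ (by simp [ha])
  set V := LInf.comp p g hg1 with hV
  have hVn : ∀ u, ‖V u‖ ≤ ‖u‖ := fun u => LInf.norm_le _ _ (norm_nonneg _) (fun a => by
    rw [LInf.comp_apply, abs_mul]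
    have := LInf.abs_le u (p a)
    nlinarith [hg1 a, abs_nonneg (g a), abs_nonneg (u (p a))])
  have hup1 : ∀ u, ‖u‖ ≤ 1 → ‖U (V u)‖ ≤ (1 + η) * L := fun u hu =>
    (hAt _ ((hVn u).trans hu) (fun i hi => by rw [LInf.comp_apply, hgA i hi, mul_zero])).trans ht.le
  have hup2 : ∀ u, ‖U (V u)‖ ≤ (1 + η) * L * ‖u‖ := by
    intro u
    rcases eq_or_ne u 0 with rfl | hu
    · simp
    have hu0 : 0 < ‖u‖ := norm_pos_iff.mpr hu
    have := hup1 (‖u‖⁻¹ • u) (by rw [norm_smul]; simp [hu0.ne'])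
    rw [map_smul, map_smul, norm_smul, norm_inv, norm_norm, inv_mul_le_iff₀ hu0] at this
    linarith
  have hlow2 : ∀ u, (1 - 3 * η) * L * ‖u‖ ≤ ‖U (V u)‖ := by
    intro u
    have key : ∀ n, 2 * ((1 - η) * L) * |u n| ≤ ‖U (V u)‖ + (1 + η) * L * ‖u‖ := by
      intro n
      set w : LInf M := LInf.mk (fun k => if k = n then u k else - u k) ‖u‖ (fun k => by
        split_ifs
        · exact LInf.abs_le u k
        · rw [abs_neg]; exact LInf.abs_le u k) with hw
      have hwn : ‖w‖ ≤ ‖u‖ := LInf.norm_le _ _ (norm_nonneg _) (fun k => by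
        rw [hw, LInf.mk_apply]
        split_ifs
        · exact LInf.abs_le u k
        · rw [abs_neg]; exact LInf.abs_le u k)
      have hsum : V u + V w = (2 * u n) • x n := by
        ext a
        rw [lp.coeFn_add, Pi.add_apply, LInf.comp_apply, LInf.comp_apply, hw, LInf.mk_apply,
          lp.coeFn_smul, Pi.smul_apply, smul_eq_mul]
        by_cases h : p a = n
        · simp [h, hg]; ring
        · have : x n a = 0 := hx2 n a (by simp [h])
          simp [h, this]
      have h1 : 2 * |u n| * ‖U (x n)‖ ≤ ‖U (V u)‖ + ‖U (V w)‖ := by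
        have := norm_add_le (U (V u)) (U (V w))
        rw [← map_add, hsum, map_smul, norm_smul, Real.norm_eq_abs, abs_mul] at this
        simpa using this
      have h2 := hup2 w
      have h3 : (1 + η) * L * ‖w‖ ≤ (1 + η) * L * ‖u‖ := by gcongr
      have h4 : 2 * |u n| * ((1 - η) * L) ≤ 2 * |u n| * ‖U (x n)‖ := by
        gcongr; exact (hx3 n).le
      linarith
    have hpos : 0 < 2 * ((1 - η) * L) := by
      have : 0 < 1 - η := by linarith
      positivity
    have := LInf.norm_le u ((‖U (V u)‖ + (1 + η) * L * ‖u‖) / (2 * ((1 - η) * L)))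
      (by positivity) (fun n => by
        rw [le_div_iff₀ hpos]; linarith [key n])
    rw [le_div_iff₀ hpos] at this
    nlinarith
  have hc0 : 0 < (1 - 3 * η) * L := by
    have : 0 < 1 - 3 * η := by linarith
    positivity
  refine ⟨((1 - 3 * η) * L)⁻¹ • (U ∘ₗ V), fun u => ?_⟩
  simp only [LinearMap.smul_apply, LinearMap.comp_apply, norm_smul, norm_inv, Real.norm_eq_abs,
    abs_of_pos hc0]
  constructor
  · rw [le_inv_mul_iff₀ hc0]; exact hlow2 u
  · rw [inv_mul_le_iff₀ hc0]
    refine (hup2 u).trans ?_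
    have : (1 + η) * (L * ‖u‖) ≤ ((1 + δ) * (1 - 3 * η)) * (L * ‖u‖) := by gcongr
    linarith

set_option maxHeartbeats 1000000 in
/-- The main fixed point argument. -/
theorem embed_aux {X : Type*} [NormedAddCommGroup X] [NormedSpace ℝ X]
    (M : Type*) [MetricSpace M] (k R : ℝ) (hk : 0 < k) (hR : 0 < R)
    (hb : ∀ x y : M, dist x y ≤ k) (hd : ∀ x y : M, x ≠ y → 4 * R ≤ dist x y)
    (hc : ∀ x y z : M, x ≠ y → y ≠ z → x ≠ z → 4 * R ≤ dist x y + dist y z - dist x z)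
    (T : LInf M →ₗ[ℝ] X) (δ : ℝ) (hδ0 : 0 < δ) (hδ : 4 * (δ * (k + R)) ≤ R)
    (hT : ∀ x, ‖x‖ ≤ ‖T x‖ ∧ ‖T x‖ ≤ (1 + δ) * ‖x‖) :
    ∃ f : M → X, ∀ x y : M, ‖f x - f y‖ = dist x y := by
  set row : M → LInf (M × M) →ₗ[ℝ] LInf M := fun i =>
    LInf.comp (fun j => (i, j)) (fun _ => 1) (by simp) with hrow
  have row_apply : ∀ i G j, row i G j = G (i, j) := fun i G j => by
    simp [hrow, LInf.comp_apply]
  set F : LInf (M × M) → M → M → ℝ := fun G i j => ‖T (row i G - row j G)‖ with hF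
  set P : ℝ → Set (LInf (M × M)) := fun r => {G | (∀ i j, G (i, j) = G (j, i)) ∧
    (∀ i, G (i, i) = 0) ∧ ∀ i j, |G (i, j) - dist i j| ≤ r} with hP
  have Gnn : ∀ G ∈ P R, ∀ i j, 0 ≤ G (i, j) := by
    rintro G ⟨hs, hz, hr⟩ i j
    rcases eq_or_ne i j with rfl | hij
    · rw [hz]
    · have := hd i j hij
      have := abs_le.mp (hr i j)
      linarith
  have FA : ∀ G ∈ P R, ∀ i j, G (i, j) ≤ F G i j ∧ F G i j ≤ (1 + δ) * G (i, j) := by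
    intro G hG i j
    have hnn := Gnn G hG i j
    obtain ⟨hs, hz, hr⟩ := hG
    have hv : ∀ l, (row i G - row j G) l = G (i, l) - G (j, l) := fun l => by
      rw [lp.coeFn_sub, Pi.sub_apply, row_apply, row_apply]
    have h1 : G (i, j) ≤ ‖row i G - row j G‖ := by
      have := LInf.abs_le (row i G - row j G) j
      rw [hv, hz, sub_zero] at this
      exact (le_abs_self _).trans this
    have h2 : ‖row i G - row j G‖ ≤ G (i, j) := by
      refine LInf.norm_le _ _ hnn (fun l => ?_)
      rw [hv]
      rcases eq_or_ne i j with rfl | hij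
      · simp [hz]
      rcases eq_or_ne l j with rfl | hlj
      · rw [hz, sub_zero, abs_of_nonneg hnn]
      rcases eq_or_ne l i with rfl | hli
      · rw [hz, zero_sub, abs_neg, hs, abs_of_nonneg hnn]
      have a1 := abs_le.mp (hr i j)
      have a2 := abs_le.mp (hr i l)
      have a3 := abs_le.mp (hr j l)
      have b1 := hc i j l hij hlj.symm hli.symm
      have b2 := hc j i l hij.symm hli.symm hlj.symm
      have := dist_comm i j
      rw [abs_le]
      constructor <;> linarith
    obtain ⟨h3, h4⟩ := hT (row i G - row j G)
    exact ⟨h1.trans h3, h4.trans (by gcongr)⟩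
  have FB : ∀ G ∈ P (R / 4), ∀ H ∈ P (R / 4), ∀ i j,
      (F H i j - F G i j) ≤ (H (i, j) - G (i, j)) + (1 / 2) * ‖H - G‖ := by
    intro G hG H hH i j
    rcases eq_or_ne (‖H - G‖) 0 with h0 | h0
    · rw [norm_eq_zero, sub_eq_zero] at h0
      simp [h0]
    have hη0 : 0 < ‖H - G‖ := lt_of_le_of_ne (norm_nonneg _) h0.symm
    have hHG : ∀ a b, |H (a, b) - G (a, b)| ≤ ‖H - G‖ := fun a b => by
      have := LInf.abs_le (H - G) (a, b)
      rwa [lp.coeFn_sub, Pi.sub_apply] at this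
    have hηR : ‖H - G‖ ≤ R / 2 := LInf.norm_le _ _ (by positivity) (fun ⟨a, b⟩ => by
      rw [lp.coeFn_sub, Pi.sub_apply]
      have a1 := abs_le.mp (hG.2.2 a b)
      have a2 := abs_le.mp (hH.2.2 a b)
      rw [abs_le]; constructor <;> linarith)
    set η := ‖H - G‖ with hη
    set t := R / (2 * η) with ht
    have ht1 : 1 ≤ t := by rw [ht, le_div_iff₀ (by positivity)]; linarith
    have ht0 : 0 < t := by positivity
    have htη : t * η = R / 2 := by rw [ht]; field_simp
    set s := t⁻¹ with hs
    have hst : s * t = 1 := inv_mul_cancel₀ ht0.ne'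
    have hs0 : 0 < s := by positivity
    have hs1 : s ≤ 1 := inv_le_one_of_one_le₀ ht1
    set Q := G + t • (H - G) with hQ
    have hQa : ∀ a, Q a = G a + t * (H a - G a) := fun a => by
      rw [hQ, lp.coeFn_add, Pi.add_apply, lp.coeFn_smul, Pi.smul_apply, lp.coeFn_sub,
        Pi.sub_apply, smul_eq_mul]
    have hQP : Q ∈ P R := by
      refine ⟨fun a b => ?_, fun a => ?_, fun a b => ?_⟩
      · rw [hQa, hQa, hG.1, hH.1]
      · rw [hQa, hG.2.1, hH.2.1]; simp
      · rw [hQa]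
        have a1 := abs_le.mp (hG.2.2 a b)
        have a2 := abs_le.mp (hHG a b)
        rw [abs_le]; constructor <;> nlinarith
    have hGP : G ∈ P R := ⟨hG.1, hG.2.1, fun a b => (hG.2.2 a b).trans (by linarith)⟩
    have hHeq : H = (1 - s) • G + s • Q := by
      rw [hQ, smul_add, smul_smul, hst]; module
    have hconv : F H i j ≤ (1 - s) * F G i j + s * F Q i j := by
      have e1 : T (row i H - row j H) = (1 - s) • T (row i G - row j G) +
          s • T (row i Q - row j Q) := by
        rw [← map_smul, ← map_smul, ← map_add]
        congr 1
        rw [hHeq]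
        simp only [map_add, map_smul]
        module
      simp only [hF]
      rw [e1]
      refine (norm_add_le _ _).trans ?_
      rw [norm_smul, norm_smul, Real.norm_eq_abs, Real.norm_eq_abs, abs_of_nonneg hs0.le,
        abs_of_nonneg (by linarith)]
    obtain ⟨g1, g2⟩ := FA G hGP i j
    obtain ⟨q1, q2⟩ := FA Q hQP i j
    have hQk : Q (i, j) ≤ k + R := by
      have := abs_le.mp (hQP.2.2 i j)
      have := hb i j
      linarith
    have hδQ : δ * Q (i, j) ≤ R / 4 := by
      have : δ * Q (i, j) ≤ δ * (k + R) := by gcongr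
      linarith
    have h5 : F Q i j - F G i j ≤ t * (H (i, j) - G (i, j)) + R / 4 := by
      have := hQa (i, j)
      linarith
    have h6 : s * (F Q i j - F G i j) ≤ s * (t * (H (i, j) - G (i, j)) + R / 4) := by gcongr
    have h7 : s * (t * (H (i, j) - G (i, j)) + R / 4) = (H (i, j) - G (i, j)) + (1 / 2) * η := by
      have : R / 4 = (1 / 2) * (t * η) := by rw [htη]; ring
      rw [this]
      linear_combination ((H (i, j) - G (i, j)) + (1 / 2) * η) * hst
    linarith
  -- the contraction
  set E := P (R / 4) with hE
  have hEP : E ⊆ P R := fun G hG => ⟨hG.1, hG.2.1, fun a b => (hG.2.2 a b).trans (by linarith)⟩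
  have hψb : ∀ G ∈ E, ∀ i j, |G (i, j) - F G i j| ≤ R / 4 := by
    intro G hG i j
    obtain ⟨g1, g2⟩ := FA G (hEP hG) i j
    have hQk : G (i, j) ≤ k + R := by
      have := abs_le.mp ((hEP hG).2.2 i j)
      have := hb i j
      linarith
    have : δ * G (i, j) ≤ δ * (k + R) := by gcongr
    rw [abs_le]; constructor <;> linarith
  have hψb2 : ∀ G ∈ E, ∀ a : M × M, |G a + dist a.1 a.2 - F G a.1 a.2| ≤ R / 4 + k := by
    rintro G hG ⟨i, j⟩
    have h1 := abs_le.mp (hψb G hG i j)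
    have h2 := hb i j
    have h3 : 0 ≤ dist i j := dist_nonneg
    rw [abs_le]; constructor <;> simp only <;> linarith
  set Ψ : E → LInf (M × M) := fun G =>
    LInf.mk (fun a => G.1 a + dist a.1 a.2 - F G.1 a.1 a.2) (R / 4 + k) (hψb2 G.1 G.2) with hΨ
  have hΨa : ∀ G : E, ∀ i j, Ψ G (i, j) = G.1 (i, j) + dist i j - F G.1 i j := fun _ _ _ => rfl
  have hΨE : ∀ G : E, Ψ G ∈ E := by
    rintro ⟨G, hG⟩
    refine ⟨fun i j => ?_, fun i => ?_, fun i j => ?_⟩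
    · rw [hΨa, hΨa, hG.1 i j, dist_comm i j]
      simp only [hF]
      rw [← norm_neg, ← map_neg, neg_sub]
    · rw [hΨa]
      simp [hF, hG.2.1]
    · rw [hΨa]
      have := hψb G hG i j
      convert this using 2
      ring
  have hEne : Nonempty E := by
    refine ⟨⟨LInf.mk (fun a => dist a.1 a.2) k (fun a => ?_), fun i j => ?_, fun i => ?_,
      fun i j => ?_⟩⟩
    · rw [abs_of_nonneg dist_nonneg]; exact hb _ _
    · exact dist_comm i j
    · exact dist_self i
    · rw [LInf.mk_apply, sub_self, abs_zero]; positivity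
  have hcont : ∀ a : M × M, Continuous (fun G : LInf (M × M) => (G a : ℝ)) := by
    intro a
    refine (LipschitzWith.of_dist_le_mul (K := 1) (fun G H => ?_)).continuous
    have := LInf.abs_le (G - H) a
    rw [lp.coeFn_sub, Pi.sub_apply] at this
    rw [Real.dist_eq, dist_eq_norm]
    simpa using this
  have hcont2 : ∀ i j : M, Continuous (fun G : LInf (M × M) => |(G (i, j) : ℝ) - dist i j|) := by
    intro i j
    have h : Continuous (fun x : ℝ => |x - dist i j|) := by fun_prop
    exact h.comp (hcont (i, j))
  have hEcl : IsClosed E := by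
    have : E = (⋂ i, ⋂ j, {G | G (i, j) = G (j, i)}) ∩ ((⋂ i, {G | G (i, i) = 0}) ∩
        (⋂ i, ⋂ j, {G | |G (i, j) - dist i j| ≤ R / 4})) := by
      ext G; simp [hE, hP]
    rw [this]
    refine IsClosed.inter ?_ (IsClosed.inter ?_ ?_)
    · exact isClosed_iInter fun i => isClosed_iInter fun j => isClosed_eq (hcont _) (hcont _)
    · exact isClosed_iInter fun i => isClosed_eq (hcont _) continuous_const
    · exact isClosed_iInter fun i => isClosed_iInter fun j =>
        isClosed_le (hcont2 i j) continuous_const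
  have : CompleteSpace E := hEcl.completeSpace_coe
  have hcontr : ContractingWith (1 / 2) (fun G : E => (⟨Ψ G, hΨE G⟩ : E)) := by
    refine ⟨by rw [← NNReal.coe_lt_coe]; norm_num, LipschitzWith.of_dist_le_mul fun G H => ?_⟩
    rw [Subtype.dist_eq, Subtype.dist_eq, dist_eq_norm, dist_eq_norm]
    refine LInf.norm_le _ _ (by positivity) ?_
    rintro ⟨i, j⟩
    rw [lp.coeFn_sub, Pi.sub_apply, hΨa, hΨa]
    have h1 := FB G.1 G.2 H.1 H.2 i j
    have h2 := FB H.1 H.2 G.1 G.2 i j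
    rw [norm_sub_rev] at h1
    rw [abs_le]
    push_cast
    constructor <;> linarith
  set G := ContractingWith.fixedPoint _ hcontr with hG
  have hfix : (⟨Ψ G, hΨE G⟩ : E) = G := hcontr.fixedPoint_isFixedPt
  refine ⟨fun i => T (row i G.1), fun i j => ?_⟩
  have h1 : Ψ G (i, j) = G.1 (i, j) := by
    have := congrArg Subtype.val hfix
    exact congrArg (fun u : LInf (M × M) => u (i, j)) this
  rw [hΨa] at h1
  have h2 : F G.1 i j = dist i j := by linarith
  rw [← map_sub]
  exact h2

/-- If a real Banach space `X` contains an isomorphic copy of `ℓ∞` (a closed linear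
subspace linearly homeomorphic to `ℓ∞`), then every bounded separable strongly
concave metric space embeds isometrically into `X`. -/
theorem embeds_of_contains_linfty {X : Type*} [NormedAddCommGroup X]
    [NormedSpace ℝ X] [CompleteSpace X]
    (hX : ∃ Y : Subspace ℝ X, IsClosed (Y : Set X) ∧
      Nonempty ((lp (fun _ : ℕ => ℝ) ∞) ≃L[ℝ] Y))
    (M : Type*) [MetricSpace M] [TopologicalSpace.SeparableSpace M]
    (hbdd : ∃ k : ℝ, 0 < k ∧ ∀ x y : M, dist x y ≤ k)
    (hconc : ∃ c : ℝ, 0 < c ∧ ∀ x y z : M, x ≠ y → y ≠ z → x ≠ z →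
      c ≤ dist x y + dist y z - dist x z) :
    ∃ f : M → X, ∀ x y : M, ‖f x - f y‖ = dist x y := by
  obtain ⟨Y, -, ⟨e⟩⟩ := hX
  obtain ⟨k, hk, hb⟩ := hbdd
  obtain ⟨c, hc, hconc⟩ := hconc
  obtain ⟨R, hR, hd, hc'⟩ : ∃ R : ℝ, 0 < R ∧ (∀ x y : M, x ≠ y → 4 * R ≤ dist x y) ∧
      ∀ x y z : M, x ≠ y → y ≠ z → x ≠ z → 4 * R ≤ dist x y + dist y z - dist x z := by
    by_cases h3 : ∃ x y z : M, x ≠ y ∧ y ≠ z ∧ x ≠ z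
    · refine ⟨c / 4, by positivity, fun x y hxy => ?_, fun x y z h1 h2 h3 => ?_⟩
      · obtain ⟨z, hxz, hyz⟩ : ∃ z, x ≠ z ∧ y ≠ z := by
          obtain ⟨a, b, d, h1, h2, h3⟩ := h3
          by_contra! hcon
          have qa : x = a ∨ y = a := or_iff_not_imp_left.mpr (hcon a)
          have qb : x = b ∨ y = b := or_iff_not_imp_left.mpr (hcon b)
          have qd : x = d ∨ y = d := or_iff_not_imp_left.mpr (hcon d)
          grind
        have h1 := hconc x y z hxy hyz hxz
        have h2 := hconc y x z hxy.symm hxz hyz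
        rw [dist_comm y x] at h2
        linarith
      · linarith [hconc x y z h1 h2 h3]
    · push Not at h3
      by_cases h2 : ∃ x y : M, x ≠ y
      · obtain ⟨a, b, hab⟩ := h2
        have hpos := dist_pos.mpr hab
        refine ⟨dist a b / 4, by positivity, fun x y hxy => ?_, fun x y z h1 h2 h4 =>
          absurd (h3 x y z h1 h2) h4⟩
        have : (x = a ∧ y = b) ∨ (x = b ∧ y = a) := by
          have := h3 a b x
          have := h3 b a x
          have := h3 a b y
          have := h3 b a y
          grind
        rcases this with ⟨rfl, rfl⟩ | ⟨rfl, rfl⟩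
        · linarith
        · rw [dist_comm]; linarith
      · push Not at h2
        exact ⟨1, one_pos, fun x y h => absurd (h2 x y) h, fun x y z h => absurd (h2 x y) h⟩
  rcases isEmpty_or_nonempty M with hM | hM
  · exact ⟨fun x => isEmptyElim x, fun x => isEmptyElim x⟩
  have : DiscreteTopology M := DiscreteTopology.of_forall_le_dist (r := 4 * R) (by positivity)
    (fun x y h => hd x y h)
  have : Countable M := TopologicalSpace.separableSpace_iff_countable.mp inferInstance
  set δ := R / (4 * (k + R)) with hδ
  obtain ⟨K, hK⟩ : ∃ K : ℝ, ∀ y : Y, ‖e.symm y‖ ≤ K * ‖y‖ :=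
    ⟨‖(e.symm : Y →L[ℝ] LInf ℕ)‖, fun y => (e.symm : Y →L[ℝ] LInf ℕ).le_opNorm y⟩
  obtain ⟨T, hT⟩ := almost_isometric (Y.subtype ∘ₗ (e : LInf ℕ →L[ℝ] Y).toLinearMap)
    (|K| + 1)⁻¹ ‖(e : LInf ℕ →L[ℝ] Y)‖ (by positivity) (fun x => by
      rw [inv_mul_le_iff₀ (by positivity)]
      have := hK (e x)
      rw [e.symm_apply_apply] at this
      refine this.trans ?_
      change K * ‖e x‖ ≤ (|K| + 1) * ‖e x‖
      gcongr
      linarith [le_abs_self K]) (fun x => (e : LInf ℕ →L[ℝ] Y).le_opNorm x) M δ (by positivity)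
  refine embed_aux M k R hk hR hb hd hc' T δ (by positivity) ?_ hT
  rw [hδ]
  apply le_of_eq
  field_simp
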